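/- Let f, g : ℝ^d → [0,+∞] be measurable, and let G be a Borel measure on (0,+∞) with tail Ḡ finite on (0,+∞). Assume G is finite or both f and g are bounded, and assume that for every δ ∈ (0,1) there exists R > 0 such that (1−δ)g(x) ≤ f(x) ≤ (1+δ)g(x) for all ‖x‖ > R. Then α(f,G) = α(g,G). -/

import Mathlib

open MeasureTheory ENNReal Filter

noncomputable section

variable {E : Type*} [NormedAddCommGroup E] [MeasureSpace E]

/-- The integrand `x ↦ Ḡ(u / h x)` with the conventions `Ḡ(u/h(x)) = 0` when `h x = 0`
and `Ḡ(u/h(x)) = G((0,∞))` when `h x = ∞`. -/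
def tailIntegrand (G : Measure ℝ) (h : E → ℝ≥0∞) (u : ℝ) (x : E) : ℝ≥0∞ :=
  if h x = 0 then 0
  else if h x = ⊤ then G (Set.Ioi (0 : ℝ))
  else G (Set.Ioi (u / (h x).toReal))

/-- `α(h,G) = inf{u > 0 : ∫ Ḡ(u/h(x)) dx < ∞}`, with `inf ∅ = ∞` (computed in `ℝ≥0∞`). -/
def alphaCoef (G : Measure ℝ) (h : E → ℝ≥0∞) : ℝ≥0∞ :=
  sInf (ENNReal.ofReal '' {u : ℝ | 0 < u ∧ (∫⁻ x, tailIntegrand G h u x) < ⊤})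

/-- `h⁺_ε(x) = sup_{‖z‖ ≤ ε} h (x + z)` -/
def supBall (h : E → ℝ≥0∞) (ε : ℝ) (x : E) : ℝ≥0∞ :=
  ⨆ z ∈ Metric.closedBall (0 : E) ε, h (x + z)

/-- `h⁻_ε(x) = inf_{‖z‖ ≤ ε} h (x + z)` -/
def infBall (h : E → ℝ≥0∞) (ε : ℝ) (x : E) : ℝ≥0∞ :=
  ⨅ z ∈ Metric.closedBall (0 : E) ε, h (x + z)

/-- `α⁺(h,G) = α(h⁺,G)` with `h⁺ = h⁺_1`. -/
def alphaPlus (G : Measure ℝ) (h : E → ℝ≥0∞) : ℝ≥0∞ := alphaCoef G (supBall h 1)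

/-- `α⁻(h,G) = sup_{ε > 0} α(h⁻_ε, G) = lim_{ε → 0} α(h⁻_ε, G)`. -/
def alphaMinus (G : Measure ℝ) (h : E → ℝ≥0∞) : ℝ≥0∞ :=
  ⨆ ε ∈ Set.Ioi (0 : ℝ), alphaCoef G (infBall h ε)

/-- A pointwise comparison `f x ≤ c * g x` rescales the tail integrand. -/
lemma tailIntegrand_mul_le {E : Type*} [NormedAddCommGroup E] [MeasureSpace E]
    (G : Measure ℝ) {f g : E → ℝ≥0∞} {c u : ℝ} (hc : 0 < c) (hu : 0 < u) {x : E}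
    (h : f x ≤ ENNReal.ofReal c * g x) :
    tailIntegrand G f (c * u) x ≤ tailIntegrand G g u x := by
  unfold tailIntegrand
  by_cases hf0 : f x = 0
  · simp [hf0]
  have hg0 : g x ≠ 0 := by
    intro h0
    simp [h0, hf0] at h
  rw [if_neg hf0, if_neg hg0]
  by_cases hgt : g x = ⊤
  · rw [if_pos hgt]
    split_ifs
    · exact le_rfl
    · exact measure_mono (Set.Ioi_subset_Ioi (by positivity))
  have hcg : ENNReal.ofReal c * g x ≠ ⊤ := ENNReal.mul_ne_top ENNReal.ofReal_ne_top hgt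
  have hft : f x ≠ ⊤ := ne_top_of_le_ne_top hcg h
  rw [if_neg hft, if_neg hgt]
  have hfp : 0 < (f x).toReal := ENNReal.toReal_pos hf0 hft
  have hgp : 0 < (g x).toReal := ENNReal.toReal_pos hg0 hgt
  have hle : (f x).toReal ≤ c * (g x).toReal := by
    have := ENNReal.toReal_mono hcg h
    rwa [ENNReal.toReal_mul, ENNReal.toReal_ofReal hc.le] at this
  refine measure_mono (Set.Ioi_subset_Ioi ?_)
  rw [div_le_div_iff₀ hgp hfp]
  nlinarith

/-- The tail integrand is bounded if `G` is finite or `f` is bounded. -/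
lemma exists_tailIntegrand_le {E : Type*} [NormedAddCommGroup E] [MeasureSpace E]
    (G : Measure ℝ) (htail : ∀ u : ℝ, 0 < u → G (Set.Ioi u) < ⊤) {f : E → ℝ≥0∞}
    (hfin : IsFiniteMeasure G ∨ ∃ B : ℝ≥0∞, B ≠ ⊤ ∧ ∀ x, f x ≤ B) {u : ℝ} (hu : 0 < u) :
    ∃ K : ℝ≥0∞, K ≠ ⊤ ∧ ∀ x, tailIntegrand G f u x ≤ K := by
  rcases hfin with hG | ⟨B, hB, hfB⟩
  · refine ⟨G Set.univ, measure_ne_top G _, fun x => ?_⟩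
    unfold tailIntegrand
    split_ifs
    · exact zero_le
    all_goals exact measure_mono (Set.subset_univ _)
  · have hB1 : 0 < B.toReal + 1 := by positivity
    refine ⟨G (Set.Ioi (u / (B.toReal + 1))), (htail _ (by positivity)).ne, fun x => ?_⟩
    have hft : f x ≠ ⊤ := ne_top_of_le_ne_top hB (hfB x)
    unfold tailIntegrand
    by_cases hf0 : f x = 0
    · simp [hf0]
    rw [if_neg hf0, if_neg hft]
    have hfp : 0 < (f x).toReal := ENNReal.toReal_pos hf0 hft
    have hle : (f x).toReal ≤ B.toReal := ENNReal.toReal_mono hB (hfB x)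
    exact measure_mono (Set.Ioi_subset_Ioi
      (div_le_div_of_nonneg_left hu.le hfp (by linarith)))

/-- Asymptotic domination up to factors arbitrarily close to `1` gives `α(f,G) ≤ α(g,G)`. -/
lemma alphaCoef_le_of_le_at_infinity {d : ℕ} (G : Measure ℝ)
    (htail : ∀ u : ℝ, 0 < u → G (Set.Ioi u) < ⊤)
    {f g : EuclideanSpace ℝ (Fin d) → ℝ≥0∞}
    (hfin : IsFiniteMeasure G ∨ ∃ B : ℝ≥0∞, B ≠ ⊤ ∧ ∀ x, f x ≤ B)
    (h : ∀ c : ℝ, 1 < c → ∃ R : ℝ, ∀ x : EuclideanSpace ℝ (Fin d), R < ‖x‖ →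
      f x ≤ ENNReal.ofReal c * g x) :
    alphaCoef G f ≤ alphaCoef G g := by
  refine le_sInf ?_
  rintro _ ⟨u, ⟨hu, hint⟩, rfl⟩
  refine le_of_forall_gt fun b hb => ?_
  obtain ⟨v, -, huv, hvb⟩ := ENNReal.lt_iff_exists_real_btwn.1 hb
  refine lt_of_le_of_lt (sInf_le ⟨v, ?_, rfl⟩) hvb
  have huv' : u < v := (ENNReal.ofReal_lt_ofReal_iff_of_nonneg hu.le).1 huv
  have hv : 0 < v := hu.trans huv'
  refine ⟨hv, ?_⟩
  obtain ⟨R, hR⟩ := h (v / u) ((one_lt_div hu).2 huv')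
  obtain ⟨K, hK, hfK⟩ := exists_tailIntegrand_le G htail hfin hv
  have hmeas : MeasurableSet (Metric.closedBall (0 : EuclideanSpace ℝ (Fin d)) R) :=
    Metric.isClosed_closedBall.measurableSet
  calc ∫⁻ x, tailIntegrand G f v x
      ≤ ∫⁻ x, (tailIntegrand G g u x
          + (Metric.closedBall (0 : EuclideanSpace ℝ (Fin d)) R).indicator (fun _ => K) x) := by
        refine lintegral_mono fun x => ?_
        by_cases hx : R < ‖x‖
        · have := tailIntegrand_mul_le G (div_pos hv hu) hu (hR x hx)
          rw [div_mul_cancel₀ v hu.ne'] at this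
          exact this.trans le_self_add
        · rw [Set.indicator_of_mem (by simpa using hx)]
          exact (hfK x).trans le_add_self
    _ = (∫⁻ x, tailIntegrand G g u x)
          + K * volume (Metric.closedBall (0 : EuclideanSpace ℝ (Fin d)) R) := by
        rw [lintegral_add_right _ (measurable_const.indicator hmeas),
          lintegral_indicator_const hmeas]
    _ < ⊤ := ENNReal.add_lt_top.2
        ⟨hint, ENNReal.mul_lt_top hK.lt_top measure_closedBall_lt_top⟩

/-- If `G` is finite or both `f` and `g` are bounded, and `f` and `g` are equivalent at
infinity in the sense that for every `δ ∈ (0,1)` one has `(1-δ)g ≤ f ≤ (1+δ)g` outside a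
ball, then `α(f,G) = α(g,G)`. -/
theorem alpha_eq_of_equiv_at_infinity
    {d : ℕ} (hd : 1 ≤ d) (G : Measure ℝ)
    (htail : ∀ u : ℝ, 0 < u → G (Set.Ioi u) < ⊤)
    (f g : EuclideanSpace ℝ (Fin d) → ℝ≥0∞) (hf : Measurable f) (hg : Measurable g)
    (hfin : IsFiniteMeasure G ∨
      ((∃ B : ℝ≥0∞, B ≠ ⊤ ∧ ∀ x, f x ≤ B) ∧ (∃ B : ℝ≥0∞, B ≠ ⊤ ∧ ∀ x, g x ≤ B)))
    (hequiv : ∀ δ : ℝ, 0 < δ → δ < 1 → ∃ R : ℝ, 0 < R ∧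
      ∀ x : EuclideanSpace ℝ (Fin d), R < ‖x‖ →
        ENNReal.ofReal (1 - δ) * g x ≤ f x ∧ f x ≤ ENNReal.ofReal (1 + δ) * g x) :
    alphaCoef G f = alphaCoef G g := by
  apply le_antisymm
  · refine alphaCoef_le_of_le_at_infinity G htail (hfin.imp_right And.left) fun c hc => ?_
    obtain ⟨R, -, hR⟩ := hequiv (min (c - 1) (1 / 2)) (lt_min (by linarith) (by norm_num))
      ((min_le_right _ _).trans_lt (by norm_num))
    refine ⟨R, fun x hx => (hR x hx).2.trans ?_⟩
    gcongr
    linarith [min_le_left (c - 1) (1 / 2)]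
  · refine alphaCoef_le_of_le_at_infinity G htail (hfin.imp_right And.right) fun c hc => ?_
    have hc0 : 0 < c := by linarith
    have hci : c⁻¹ < 1 := inv_lt_one_of_one_lt₀ hc
    have hci0 : 0 < c⁻¹ := inv_pos.2 hc0
    obtain ⟨R, -, hR⟩ := hequiv (1 - c⁻¹) (by linarith) (by linarith)
    refine ⟨R, fun x hx => ?_⟩
    have := (hR x hx).1
    rw [_root_.sub_sub_cancel] at this
    calc g x = ENNReal.ofReal c * (ENNReal.ofReal c⁻¹ * g x) := by
          rw [← mul_assoc, ← ENNReal.ofReal_mul hc0.le, mul_inv_cancel₀ hc0.ne',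
            ENNReal.ofReal_one, one_mul]
      _ ≤ ENNReal.ofReal c * f x := by gcongr
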